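/- Let k, p, n ∈ ℕ with k even, 2 ≤ k ≤ n and kp ≤ n, and for each A ∈ T^1_{k−1} let D^A ∈ Λ^{kp} satisfy e^1⌟D^A = 0. Assume Σ_{A∈T^1_{k−1}} ⟨D^A; ω^{p−1}∧(a∧b)⟩⟨a∧b; e^1∧e^A⟩ = 0 for all ω ∈ Λ^k, a ∈ Λ^1, b ∈ Λ^{k−1}. Then for all I, R ∈ T^1_{k−1} and J, S ∈ T_{kp} satisfying I∩J = ∅, R∩S = ∅ and I∪J = R∪S (as sets), one has sgn(I,J)⟨D^I; e^J⟩ = sgn(R,S)⟨D^R; e^S⟩. -/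

import Mathlib

/-! Basic setup: `Λᵏ(ℝⁿ)` in coordinates with respect to the standard basis
`e^I`, `I` a strictly increasing multi-index (modeled as a `k`-element subset of
`Fin n`), together with the exterior product, interior product, inner product,
Hodge star, and the various notions of one-directional convexity/affinity. -/

/-- Increasing multi-indices of length `k` in `{1,…,n}`: `k`-element subsets of `Fin n`.
`Idx n k` plays the role of `T_k`. -/
abbrev Idx (n k : ℕ) := {s : Finset (Fin n) // s.card = k}

/-- `Λᵏ(ℝⁿ)`, identified with its coordinates in the standard basis `e^I`. -/
abbrev Lam (n k : ℕ) := Idx n k → ℝ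

/-- The sign `sgn(R,S)` defined by `e^{[R,S]} = sgn(R,S) e^R ∧ e^S` for disjoint
increasing multi-indices: `(-1)` to the number of inversions between `R` and `S`. -/
def msign {n : ℕ} (R S : Finset (Fin n)) : ℝ :=
  (-1 : ℝ) ^ (((R ×ˢ S).filter (fun p => p.2 < p.1)).card)

/-- The basis form `e^S` (of degree `k = S.card`; zero if `k ≠ S.card`). -/
def bform {n k : ℕ} (S : Finset (Fin n)) : Lam n k :=
  fun I => if I.1 = S then 1 else 0

/-- Exterior (wedge) product in coordinates.  When `m = k + l` this is the wedge
product `Λᵏ × Λˡ → Λ^{k+l}`; for other `m` it is `0`. -/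
def wedge {n k l m : ℕ} (ω : Lam n k) (φ : Lam n l) : Lam n m :=
  fun I => ∑ R : Idx n k, ∑ S : Idx n l,
    if R.1 ∪ S.1 = I.1 ∧ Disjoint R.1 S.1 then msign R.1 S.1 * (ω R * φ S) else 0

/-- Interior product `a ⌟ b`, characterized by `⟨a ⌟ b; c⟩ = ⟨b; a ∧ c⟩`.  When
`m = k - j` this is the interior product `Λʲ × Λᵏ → Λ^{k-j}`; for other `m` it is `0`. -/
def iprod {n j k m : ℕ} (a : Lam n j) (b : Lam n k) : Lam n m :=
  fun C => ∑ A : Idx n j, ∑ B : Idx n k,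
    if A.1 ∪ C.1 = B.1 ∧ Disjoint A.1 C.1 then msign A.1 C.1 * (a A * b B) else 0

/-- Hodge star with respect to the standard orientation; when `m = n - k` this is
`∗ : Λᵏ → Λ^{n-k}`. -/
def hstar {n k m : ℕ} (ω : Lam n k) : Lam n m :=
  fun J => ∑ I : Idx n k, if I.1 = (J.1)ᶜ then msign I.1 J.1 * ω I else 0

/-- Inner product `⟨·;·⟩` on `Λᵏ` (the basis `e^I` is orthonormal). -/
def ip {n k : ℕ} (ω α : Lam n k) : ℝ := ∑ I : Idx n k, ω I * α I

/-- `s`-fold exterior power `ω^s = ω ∧ ⋯ ∧ ω` (with `ω^0 = 1 ∈ Λ⁰`). -/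
def lpow {n k : ℕ} (ω : Lam n k) : (s : ℕ) → Lam n (k * s)
  | 0 => bform ∅
  | s + 1 => wedge ω (lpow ω s)

/-- `f : Λᵏ → ℝ` is ext. one convex. -/
def ExtOneConvex {n k : ℕ} (f : Lam n k → ℝ) : Prop :=
  ∀ (ω : Lam n k) (a : Lam n 1) (b : Lam n (k-1)),
    ConvexOn ℝ Set.univ (fun t : ℝ => f (ω + t • (wedge a b : Lam n k)))

/-- `f : Λᵏ → ℝ` is ext. one affine. -/
def ExtOneAffine {n k : ℕ} (f : Lam n k → ℝ) : Prop :=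
  ExtOneConvex f ∧ ExtOneConvex (fun ω => -f ω)

/-- `f : Λᵏ → ℝ` is int. one convex. -/
def IntOneConvex {n k : ℕ} (f : Lam n k → ℝ) : Prop :=
  ∀ (ω : Lam n k) (a : Lam n 1) (b : Lam n (k+1)),
    ConvexOn ℝ Set.univ (fun t : ℝ => f (ω + t • (iprod a b : Lam n k)))

/-- `f : Λᵏ → ℝ` is int. one affine. -/
def IntOneAffine {n k : ℕ} (f : Lam n k → ℝ) : Prop :=
  IntOneConvex f ∧ IntOneConvex (fun ω => -f ω)

/-- `f : Λ^{k+1} × Λ^{k-1} → ℝ` is ext-int. one convex. -/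
def ExtIntOneConvex {n k : ℕ} (f : Lam n (k+1) → Lam n (k-1) → ℝ) : Prop :=
  ∀ (ξ : Lam n (k+1)) (η : Lam n (k-1)) (a : Lam n 1) (b : Lam n k),
    ConvexOn ℝ Set.univ
      (fun t : ℝ => f (ξ + t • (wedge a b : Lam n (k+1))) (η + t • (iprod a b : Lam n (k-1))))

/-- `f : Λ^{k+1} × Λ^{k-1} → ℝ` is ext-int. one affine. -/
def ExtIntOneAffine {n k : ℕ} (f : Lam n (k+1) → Lam n (k-1) → ℝ) : Prop :=
  ExtIntOneConvex f ∧ ExtIntOneConvex (fun ξ η => -f ξ η)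

/-- `g : Λᵏ → ℝ` is affine, i.e. a constant plus a linear functional. -/
def AffineFn {n k : ℕ} (g : Lam n k → ℝ) : Prop :=
  ∃ (c : ℝ) (a : Lam n k), ∀ ω, g ω = c + ip a ω

section Wedge

variable {n k l m : ℕ}

theorem wedge_add_left (x y : Lam n k) (z : Lam n l) :
    (wedge (x + y) z : Lam n m) = wedge x z + wedge y z := by
  funext I
  simp only [wedge, Pi.add_apply, ← Finset.sum_add_distrib]
  refine Finset.sum_congr rfl fun R _ => Finset.sum_congr rfl fun S _ => ?_
  split_ifs <;> ring

theorem wedge_add_right (x : Lam n k) (y z : Lam n l) :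
    (wedge x (y + z) : Lam n m) = wedge x y + wedge x z := by
  funext I
  simp only [wedge, Pi.add_apply, ← Finset.sum_add_distrib]
  refine Finset.sum_congr rfl fun R _ => Finset.sum_congr rfl fun S _ => ?_
  split_ifs <;> ring

theorem wedge_smul_left (c : ℝ) (x : Lam n k) (z : Lam n l) :
    (wedge (c • x) z : Lam n m) = c • wedge x z := by
  funext I
  simp only [wedge, Pi.smul_apply, smul_eq_mul, Finset.mul_sum]
  refine Finset.sum_congr rfl fun R _ => Finset.sum_congr rfl fun S _ => ?_
  split_ifs <;> ring

theorem wedge_smul_right (c : ℝ) (x : Lam n k) (z : Lam n l) :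
    (wedge x (c • z) : Lam n m) = c • wedge x z := by
  funext I
  simp only [wedge, Pi.smul_apply, smul_eq_mul, Finset.mul_sum]
  refine Finset.sum_congr rfl fun R _ => Finset.sum_congr rfl fun S _ => ?_
  split_ifs <;> ring

theorem ip_add_left (x y z : Lam n k) : ip (x + y) z = ip x z + ip y z := by
  simp [ip, add_mul, Finset.sum_add_distrib]

theorem ip_add_right (x y z : Lam n k) : ip x (y + z) = ip x y + ip x z := by
  simp [ip, mul_add, Finset.sum_add_distrib]

theorem ip_smul_left (c : ℝ) (x z : Lam n k) : ip (c • x) z = c * ip x z := by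
  simp [ip, Finset.mul_sum, mul_assoc]

theorem ip_smul_right (c : ℝ) (x z : Lam n k) : ip x (c • z) = c * ip x z := by
  simp [ip, Finset.mul_sum, mul_left_comm]

theorem ip_bform (x : Lam n k) (J : Idx n k) : ip x (bform J.1) = x J := by
  simp [ip, bform, Subtype.ext_iff.symm]

theorem wedge_bform_bform {R S : Finset (Fin n)} (hR : R.card = k) (hS : S.card = l) :
    (wedge (bform R : Lam n k) (bform S : Lam n l) : Lam n m) =
      (if Disjoint R S then msign R S else 0) • bform (R ∪ S) := by
  funext I
  simp only [wedge, Pi.smul_apply, smul_eq_mul]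
  rw [Finset.sum_eq_single (⟨R, hR⟩ : Idx n k), Finset.sum_eq_single (⟨S, hS⟩ : Idx n l)]
  · by_cases h : Disjoint R S <;> by_cases h' : R ∪ S = I.1 <;>
      simp [bform, h, h', eq_comm (a := I.1) (b := R ∪ S)]
  · intro S' _ hne
    have : S'.1 ≠ S := fun h => hne (Subtype.ext h)
    simp [bform, this]
  · simp
  · intro R' _ hne
    have : R'.1 ≠ R := fun h => hne (Subtype.ext h)
    simp [bform, this]
  · simp

theorem wedge_bform_of_disjoint {R S : Finset (Fin n)} (hR : R.card = k) (hS : S.card = l)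
    (h : Disjoint R S) :
    (wedge (bform R : Lam n k) (bform S : Lam n l) : Lam n m) = msign R S • bform (R ∪ S) := by
  rw [wedge_bform_bform hR hS, if_pos h]

end Wedge

section Sign

variable {n : ℕ}

theorem msign_union_left {A B : Finset (Fin n)} (X : Finset (Fin n)) (h : Disjoint A B) :
    msign (A ∪ B) X = msign A X * msign B X := by
  unfold msign
  rw [← pow_add, Finset.union_product, Finset.filter_union, Finset.card_union_of_disjoint]
  refine Finset.disjoint_filter_filter ?_
  exact Finset.disjoint_product.2 (Or.inl h)

theorem msign_union_right (X : Finset (Fin n)) {A B : Finset (Fin n)} (h : Disjoint A B) :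
    msign X (A ∪ B) = msign X A * msign X B := by
  unfold msign
  rw [← pow_add, Finset.product_union, Finset.filter_union, Finset.card_union_of_disjoint]
  refine Finset.disjoint_filter_filter ?_
  exact Finset.disjoint_product.2 (Or.inr h)

theorem msign_mul_self (A B : Finset (Fin n)) : msign A B * msign A B = 1 := by
  unfold msign
  rw [← mul_pow]
  norm_num

theorem msign_mul_msign_swap {A B : Finset (Fin n)} (h : Disjoint A B) :
    msign A B * msign B A = (-1) ^ (A.card * B.card) := by
  unfold msign
  have hswap : ((B ×ˢ A).filter fun p => p.2 < p.1).card =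
      ((A ×ˢ B).filter fun p => ¬ p.2 < p.1).card := by
    refine Finset.card_bij' (fun p _ => p.swap) (fun p _ => p.swap) ?_ ?_ ?_ ?_
    · rintro ⟨b, a⟩ hp
      simp only [Finset.mem_filter, Finset.mem_product, Prod.swap] at hp ⊢
      exact ⟨hp.1.symm, not_lt.2 hp.2.le⟩
    · rintro ⟨a, b⟩ hp
      simp only [Finset.mem_filter, Finset.mem_product, Prod.swap, not_lt] at hp ⊢
      exact ⟨hp.1.symm, hp.2.lt_of_ne (Finset.disjoint_iff_ne.1 h a hp.1.1 b hp.1.2)⟩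
    · simp
    · simp
  rw [hswap, ← pow_add, Finset.card_filter_add_card_filter_not, Finset.card_product]

theorem msign_eq_one_of_lt {A B : Finset (Fin n)} (h : ∀ x ∈ A, ∀ y ∈ B, x < y) :
    msign A B = 1 := by
  unfold msign
  rw [Finset.filter_eq_empty_iff.2, Finset.card_empty, pow_zero]
  rintro ⟨x, y⟩ hp
  rw [Finset.mem_product] at hp
  exact not_lt.2 (h x hp.1 y hp.2).le

theorem msign_eq_one_of_gt {A B : Finset (Fin n)} (hA : Even A.card)
    (h : ∀ x ∈ A, ∀ y ∈ B, y < x) : msign A B = 1 := by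
  unfold msign
  rw [Finset.filter_true_of_mem, Finset.card_product]
  · exact (hA.mul_right _).neg_one_pow
  · rintro ⟨x, y⟩ hp
    rw [Finset.mem_product] at hp
    exact h x hp.1 y hp.2

end Sign

section Blocks

variable {n k q : ℕ}

theorem disjoint_of_ordered {B : Fin q → Finset (Fin n)}
    (hord : ∀ t u, t < u → ∀ x ∈ B t, ∀ y ∈ B u, x < y)
    {t u : Fin q} (h : t ≠ u) : Disjoint (B t) (B u) := by
  rw [Finset.disjoint_left]
  intro x hx hx'
  rcases lt_or_gt_of_ne h with h | h
  · exact lt_irrefl x (hord t u h x hx x hx')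
  · exact lt_irrefl x (hord u t h x hx' x hx)

theorem exists_ordered_blocks {M : Finset (Fin n)} (hM : M.card = k * q) :
    ∃ B : Fin q → Finset (Fin n), (∀ t, (B t).card = k) ∧
      (∀ t u, t < u → ∀ x ∈ B t, ∀ y ∈ B u, x < y) ∧ Finset.univ.biUnion B = M := by
  have hlt : ∀ (t : Fin q) (i : Fin k), k * (t : ℕ) + i < k * q := fun t i =>
    calc k * (t : ℕ) + i < k * t + k := by omega
      _ = k * (t + 1) := by ring
      _ ≤ k * q := Nat.mul_le_mul_left k t.2
  set B : Fin q → Finset (Fin n) := fun t =>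
    Finset.univ.image fun i : Fin k => M.orderEmbOfFin hM ⟨k * (t : ℕ) + i, hlt t i⟩ with hB
  have hcard : ∀ t, (B t).card = k := by
    intro t
    rw [hB, Finset.card_image_of_injective, Finset.card_univ, Fintype.card_fin]
    intro i j hij
    have := (M.orderEmbOfFin hM).injective hij
    simp only [Fin.mk.injEq] at this
    exact Fin.ext (by omega)
  have hord : ∀ t u, t < u → ∀ x ∈ B t, ∀ y ∈ B u, x < y := by
    intro t u htu x hx y hy
    simp only [hB, Finset.mem_image, Finset.mem_univ, true_and] at hx hy
    obtain ⟨i, rfl⟩ := hx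
    obtain ⟨j, rfl⟩ := hy
    refine (M.orderEmbOfFin hM).strictMono ?_
    rw [Fin.mk_lt_mk]
    calc k * (t : ℕ) + i < k * t + k := by omega
      _ = k * (t + 1) := by ring
      _ ≤ k * u := Nat.mul_le_mul_left k htu
      _ ≤ k * u + j := Nat.le_add_right _ _
  refine ⟨B, hcard, hord, Finset.eq_of_subset_of_card_le ?_ ?_⟩
  · intro x hx
    simp only [hB, Finset.mem_biUnion, Finset.mem_image, Finset.mem_univ, true_and] at hx
    obtain ⟨t, i, rfl⟩ := hx
    exact M.orderEmbOfFin_mem hM _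
  · rw [Finset.card_biUnion, Finset.sum_congr rfl fun t _ => hcard t, hM]
    · simp [mul_comm]
    · exact fun t _ u _ htu => disjoint_of_ordered hord htu

/-- The sum of the basis forms of a family of blocks. -/
def blockForm (k : ℕ) (B : Fin q → Finset (Fin n)) : Lam n k :=
  open Classical in fun R => if ∃ t, R.1 = B t then 1 else 0

variable {B : Fin q → Finset (Fin n)}

theorem msign_block_biUnion (hk : Even k) (hcard : ∀ t, (B t).card = k)
    (hord : ∀ t u, t < u → ∀ x ∈ B t, ∀ y ∈ B u, x < y) (t : Fin q) (T : Finset (Fin q))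
    (ht : t ∉ T) : msign (B t) (T.biUnion B) = 1 := by
  induction T using Finset.induction_on with
  | empty => simp [msign]
  | insert u T hu ih =>
    rw [Finset.mem_insert, not_or] at ht
    rw [Finset.biUnion_insert, msign_union_right, ih ht.2, mul_one]
    · rcases lt_or_gt_of_ne ht.1 with h | h
      · exact msign_eq_one_of_lt (hord t u h)
      · exact msign_eq_one_of_gt (by rw [hcard]; exact hk) fun x hx y hy => hord u t h y hy x hx
    · rw [Finset.disjoint_biUnion_right]
      intro v hv
      exact disjoint_of_ordered hord (by rintro rfl; exact hu hv)

theorem lpow_blockForm (hk : Even k) (hk0 : 0 < k) (hcard : ∀ t, (B t).card = k)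
    (hord : ∀ t u, t < u → ∀ x ∈ B t, ∀ y ∈ B u, x < y) (s : ℕ) (X : Idx n (k * s)) :
    (∀ T : Finset (Fin q), X.1 = T.biUnion B → 0 < lpow (blockForm k B) s X) ∧
      ((¬ ∃ T : Finset (Fin q), X.1 = T.biUnion B) → lpow (blockForm k B) s X = 0) := by
  have hdisj : ∀ (t : Fin q) (T : Finset (Fin q)), Disjoint (B t) (T.biUnion B) → t ∉ T := by
    intro t T h ht
    have h1 := h.mono_right (Finset.subset_biUnion_of_mem B ht)
    rw [disjoint_self, Finset.bot_eq_empty] at h1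
    have := hcard t
    rw [h1, Finset.card_empty] at this
    omega
  induction s with
  | zero =>
    have hX : X.1 = ∅ := Finset.card_eq_zero.1 (by rw [X.2, mul_zero])
    refine ⟨fun T _ => by simp [lpow, bform, hX], fun h => absurd ⟨∅, by simp [hX]⟩ h⟩
  | succ s ih =>
    have hnn : ∀ (R : Idx n k) (S : Idx n (k * s)),
        0 ≤ if R.1 ∪ S.1 = X.1 ∧ Disjoint R.1 S.1 then
          msign R.1 S.1 * (blockForm k B R * lpow (blockForm k B) s S) else 0 := by
      intro R S
      split_ifs with h
      · by_cases hR : ∃ t, R.1 = B t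
        · obtain ⟨t, ht⟩ := hR
          by_cases hS : ∃ T : Finset (Fin q), S.1 = T.biUnion B
          · obtain ⟨T, hT⟩ := hS
            have hpos := (ih S).1 T hT
            have htT : t ∉ T := hdisj t T (by rw [← ht, ← hT]; exact h.2)
            rw [ht, hT, msign_block_biUnion hk hcard hord t T htT, one_mul]
            refine mul_nonneg ?_ hpos.le
            unfold blockForm
            split_ifs <;> norm_num
          · rw [(ih S).2 hS, mul_zero, mul_zero]
        · have : blockForm k B R = 0 := if_neg hR
          rw [this, zero_mul, mul_zero]
      · exact le_rfl
    constructor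
    · intro T hT
      have hTne : T.Nonempty := by
        rw [Finset.nonempty_iff_ne_empty]
        rintro rfl
        have hX := X.2
        rw [hT, Finset.biUnion_empty, Finset.card_empty] at hX
        exact (Nat.mul_pos hk0 (Nat.succ_pos s)).ne hX
      obtain ⟨t, ht⟩ := hTne
      have hU : B t ∪ (T.erase t).biUnion B = X.1 := by
        rw [← Finset.biUnion_insert, Finset.insert_erase ht, hT]
      have hD : Disjoint (B t) ((T.erase t).biUnion B) := by
        rw [Finset.disjoint_biUnion_right]
        intro u hu
        exact disjoint_of_ordered hord (Finset.ne_of_mem_erase hu).symm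
      have hS : ((T.erase t).biUnion B).card = k * s := by
        have h1 := Finset.card_union_of_disjoint hD
        rw [hU, X.2, hcard, mul_add, mul_one] at h1
        omega
      refine Finset.sum_pos' (fun R _ => Finset.sum_nonneg fun S _ => hnn R S)
        ⟨⟨B t, hcard t⟩, Finset.mem_univ _, ?_⟩
      refine Finset.sum_pos' (fun S _ => hnn _ S) ⟨⟨_, hS⟩, Finset.mem_univ _, ?_⟩
      rw [if_pos ⟨hU, hD⟩, msign_block_biUnion hk hcard hord t _ (Finset.notMem_erase t T), one_mul]
      refine mul_pos ?_ ((ih _).1 _ rfl)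
      have : blockForm k B ⟨B t, hcard t⟩ = 1 := if_pos ⟨t, rfl⟩
      rw [this]
      exact one_pos
    · intro hX
      rw [lpow, wedge]
      refine Finset.sum_eq_zero fun R _ => Finset.sum_eq_zero fun S _ => ?_
      split_ifs with h
      · by_cases hR : ∃ t, R.1 = B t
        · obtain ⟨t, ht⟩ := hR
          by_cases hS : ∃ T : Finset (Fin q), S.1 = T.biUnion B
          · obtain ⟨T, hT⟩ := hS
            refine absurd ⟨insert t T, ?_⟩ hX
            rw [Finset.biUnion_insert, ← ht, ← hT, h.1]
          · rw [(ih S).2 hS, mul_zero, mul_zero]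
        · have : blockForm k B R = 0 := if_neg hR
          rw [this, zero_mul, mul_zero]
      · rfl

/-- For even `k`, every basis form of degree `k * q` is a multiple of a `q`-th exterior power. -/
theorem exists_lpow_eq_smul_bform (hk : Even k) (hk0 : 0 < k) {M : Finset (Fin n)}
    (hM : M.card = k * q) :
    ∃ (ω : Lam n k) (c : ℝ), c ≠ 0 ∧ lpow ω q = c • bform M := by
  obtain ⟨B, hcard, hord, hU⟩ := exists_ordered_blocks hM
  have key := lpow_blockForm hk hk0 hcard hord q
  refine ⟨blockForm k B, lpow (blockForm k B) q ⟨M, hM⟩, ((key ⟨M, hM⟩).1 _ hU.symm).ne', ?_⟩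
  funext X
  by_cases hX : X.1 = M
  · obtain rfl : X = ⟨M, hM⟩ := Subtype.ext hX
    simp [bform]
  · rw [(key X).2]
    · simp [bform, hX]
    · rintro ⟨T, hT⟩
      refine hX (Finset.eq_of_subset_of_card_le ?_ (by rw [hM, X.2]))
      rw [hT, ← hU]
      exact Finset.biUnion_subset_biUnion_of_subset_left B (Finset.subset_univ T)

end Blocks

section Exchange

variable {n k m : ℕ}

theorem apply_eq_zero_of_iprod_eq_zero {e : Fin n} {x : Lam n m}
    (h : (iprod (bform {e} : Lam n 1) x : Lam n (m - 1)) = 0) (J : Idx n m) (he : e ∈ J.1) :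
    x J = 0 := by
  have hc : (J.1.erase e).card = m - 1 := by rw [Finset.card_erase_of_mem he, J.2]
  have h1 := congrFun h ⟨J.1.erase e, hc⟩
  have hd : Disjoint {e} (J.1.erase e) := by simp
  have hu : {e} ∪ J.1.erase e = J.1 := by
    rw [← Finset.insert_eq, Finset.insert_erase he]
  unfold iprod at h1
  rw [Finset.sum_eq_single (⟨{e}, Finset.card_singleton e⟩ : Idx n 1),
    Finset.sum_eq_single J] at h1
  · rw [if_pos ⟨hu, hd⟩] at h1
    have h2 := msign_mul_self {e} (J.1.erase e)
    have h3 : msign {e} (J.1.erase e) ≠ 0 := fun h0 => by simp [h0] at h2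
    simpa [bform, h3] using h1
  · intro K _ hK
    refine if_neg fun hh => hK (Subtype.ext ?_)
    rw [← hh.1, hu]
  · simp
  · intro A _ hA
    refine Finset.sum_eq_zero fun K _ => ?_
    have : A.1 ≠ {e} := fun hh => hA (Subtype.ext hh)
    simp [bform, this]
  · simp

/-- The bilinear form underlying the hypothesis of the theorem. -/
def pairing (e : Fin n) (D : Idx n (k - 1) → Lam n m) {r : ℕ} (μ : Lam n r) (w v : Lam n k) : ℝ :=
  ∑ A ∈ Finset.univ.filter (fun A : Idx n (k - 1) => e ∉ A.1),
    ip (D A) (wedge μ w : Lam n m) *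
      ip v (wedge (bform {e} : Lam n 1) (bform A.1 : Lam n (k - 1)))

variable {e : Fin n} {D : Idx n (k - 1) → Lam n m} {r : ℕ}

theorem pairing_add_left (μ : Lam n r) (w w' v : Lam n k) :
    pairing e D μ (w + w') v = pairing e D μ w v + pairing e D μ w' v := by
  simp only [pairing, wedge_add_right, ip_add_right, add_mul, Finset.sum_add_distrib]

theorem pairing_add_right (μ : Lam n r) (w v v' : Lam n k) :
    pairing e D μ w (v + v') = pairing e D μ w v + pairing e D μ w v' := by
  simp only [pairing, ip_add_left, mul_add, Finset.sum_add_distrib]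

theorem pairing_smul_left (μ : Lam n r) (c : ℝ) (w v : Lam n k) :
    pairing e D μ (c • w) v = c * pairing e D μ w v := by
  simp only [pairing, wedge_smul_right, ip_smul_right, Finset.mul_sum, mul_assoc]

theorem pairing_smul_right (μ : Lam n r) (c : ℝ) (w v : Lam n k) :
    pairing e D μ w (c • v) = c * pairing e D μ w v := by
  simp only [pairing, ip_smul_left, Finset.mul_sum, mul_left_comm]

theorem pairing_smul (μ : Lam n r) (c : ℝ) (w v : Lam n k) :
    pairing e D (c • μ) w v = c * pairing e D μ w v := by
  simp only [pairing, wedge_smul_left, ip_smul_right, Finset.mul_sum, mul_assoc]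

theorem pairing_bform_left_eq_zero
    (hD : ∀ A : Idx n (k - 1), e ∉ A.1 → ∀ J : Idx n m, e ∈ J.1 → D A J = 0)
    {M X : Finset (Fin n)} (hM : M.card = r) (hX : X.card = k) (heX : e ∈ X) (v : Lam n k) :
    pairing e D (bform M : Lam n r) (bform X) v = 0 := by
  refine Finset.sum_eq_zero fun A hA => ?_
  rw [wedge_bform_bform hM hX, ip_smul_right]
  suffices h : ip (D A) (bform (M ∪ X)) = 0 by rw [h]; ring
  refine Finset.sum_eq_zero fun J _ => ?_
  by_cases hJ : J.1 = M ∪ X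
  · rw [hD A (Finset.mem_filter.1 hA).2 J (by rw [hJ]; exact Finset.mem_union_right M heX), zero_mul]
  · simp [bform, hJ]

theorem pairing_bform_right_eq_zero (μ : Lam n r) (w : Lam n k) {Y : Finset (Fin n)}
    (heY : e ∉ Y) : pairing e D μ w (bform Y) = 0 := by
  refine Finset.sum_eq_zero fun A hA => ?_
  rw [wedge_bform_bform (Finset.card_singleton e) A.2, ip_smul_right]
  suffices h : ip (bform Y : Lam n k) (bform ({e} ∪ A.1)) = 0 by rw [h]; ring
  refine Finset.sum_eq_zero fun J _ => ?_
  by_cases hJ : J.1 = Y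
  · have : Y ≠ {e} ∪ A.1 := by rintro rfl; simp at heY
    simp only [bform, hJ, if_neg this, mul_zero]
  · simp [bform, hJ]

theorem pairing_bform_bform {M X : Finset (Fin n)} (hk : 1 ≤ k) (hM : M.card = r)
    (hX : X.card = k) (hMX : Disjoint M X) (A : Idx n (k - 1)) (heA : e ∉ A.1) (J : Idx n m)
    (hJ : J.1 = M ∪ X) :
    pairing e D (bform M : Lam n r) (bform X) (bform ({e} ∪ A.1)) =
      msign M X * msign {e} A.1 * D A J := by
  have hd : ∀ A' : Idx n (k - 1), e ∉ A'.1 → Disjoint {e} A'.1 := fun A' h => by simpa using h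
  have hc : ({e} ∪ A.1).card = k := by
    rw [Finset.card_union_of_disjoint (hd A heA), A.2, Finset.card_singleton]
    omega
  unfold pairing
  rw [Finset.sum_eq_single A]
  · rw [wedge_bform_of_disjoint hM hX hMX,
      wedge_bform_of_disjoint (Finset.card_singleton e) A.2 (hd A heA), ip_smul_right,
      ip_smul_right, ← hJ, ip_bform,
      ip_bform (bform ({e} ∪ A.1)) (⟨{e} ∪ A.1, hc⟩ : Idx n k)]
    simp only [bform, if_true]
    ring
  · intro A' hA' hne
    have heA' := (Finset.mem_filter.1 hA').2
    have hc' : ({e} ∪ A'.1).card = k := by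
      rw [Finset.card_union_of_disjoint (hd A' heA'), A'.2, Finset.card_singleton]
      omega
    have hne' : {e} ∪ A'.1 ≠ {e} ∪ A.1 := by
      intro h
      refine hne (Subtype.ext ?_)
      rw [← Finset.insert_eq, ← Finset.insert_eq] at h
      rw [← Finset.erase_insert heA', h, Finset.erase_insert heA]
    rw [wedge_bform_of_disjoint (Finset.card_singleton e) A'.2 (hd A' heA'), ip_smul_right,
      ip_bform (bform ({e} ∪ A.1)) (⟨{e} ∪ A'.1, hc'⟩ : Idx n k)]
    simp only [bform, if_neg hne', mul_zero]
  · intro h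
    simp [heA] at h

theorem exchange_signs {M B C : Finset (Fin n)} {i j : Fin n} (hij : i ≠ j)
    (hMB : Disjoint M B) (hiM : i ∉ M) (hjM : j ∉ M) (hiB : i ∉ B) (hjB : j ∉ B)
    (hiC : i ∉ C) (hjC : j ∉ C) :
    msign ({i} ∪ C) (M ∪ ({j} ∪ B)) * (msign {j} B * msign M ({j} ∪ B) * msign {i} C) =
      -(msign ({j} ∪ C) (M ∪ ({i} ∪ B)) * (msign {i} B * msign M ({i} ∪ B) * msign {j} C)) := by
  have d : ∀ {x : Fin n} {S : Finset (Fin n)}, x ∉ S → Disjoint {x} S := fun h => by simpa using h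
  rw [msign_union_left _ (d hiC), msign_union_left _ (d hjC)]
  have dj : Disjoint M ({j} ∪ B) := by
    rw [Finset.disjoint_union_right]; exact ⟨(d hjM).symm, hMB⟩
  have di : Disjoint M ({i} ∪ B) := by
    rw [Finset.disjoint_union_right]; exact ⟨(d hiM).symm, hMB⟩
  simp only [msign_union_right _ dj, msign_union_right _ di, msign_union_right _ (d hiB),
    msign_union_right _ (d hjB)]
  have swap : ∀ {x : Fin n} {S : Finset (Fin n)}, x ∉ S →
      msign S {x} = (-1) ^ S.card * msign {x} S := by
    intro x S h
    have h1 := msign_mul_msign_swap (d h)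
    have h2 := msign_mul_self {x} S
    rw [Finset.card_singleton, one_mul] at h1
    rw [← h1]
    linear_combination (-(msign S {x})) * h2
  rw [swap hiM, swap hjM, swap hiC, swap hjC, swap (x := i) (S := {j}) (by simpa using hij),
    Finset.card_singleton]
  ring

/-- Exchanging one element between the two multi-indices. -/
theorem exchange (hkm : 2 ≤ k) (he : (e : ℕ) = 0)
    (hD : ∀ A : Idx n (k - 1), e ∉ A.1 → ∀ J : Idx n m, e ∈ J.1 → D A J = 0)
    {M B C : Finset (Fin n)} (hM : M.card = r) (hB : B.card = k - 1) (hC : C.card = k - 2)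
    (hpair : ∀ (a : Lam n 1) (b : Lam n (k - 1)),
      pairing e D (bform M : Lam n r) (wedge a b) (wedge a b) = 0)
    {i j : Fin n} (hij : i ≠ j) (hMB : Disjoint M B)
    (hiM : i ∉ M) (hjM : j ∉ M) (hiB : i ∉ B) (hjB : j ∉ B) (hiC : i ∉ C) (hjC : j ∉ C)
    (heM : e ∉ M) (heB : e ∉ B) (heC : e ∉ C) (hie : i ≠ e) (hje : j ≠ e)
    (I I' : Idx n (k - 1)) (J J' : Idx n m) (hI : I.1 = {i} ∪ C) (hI' : I'.1 = {j} ∪ C)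
    (hJ : J.1 = M ∪ ({j} ∪ B)) (hJ' : J'.1 = M ∪ ({i} ∪ B)) :
    msign I.1 J.1 * D I J = msign I'.1 J'.1 * D I' J' := by
  have d : ∀ {x : Fin n} {S : Finset (Fin n)}, x ∉ S → Disjoint {x} S := fun h => by simpa using h
  have heC1 : ({e} ∪ C).card = k - 1 := by
    rw [Finset.card_union_of_disjoint (d heC), hC, Finset.card_singleton]; omega
  have hcB : ∀ {x : Fin n}, x ∉ B → ({x} ∪ B).card = k := fun h => by
    rw [Finset.card_union_of_disjoint (d h), hB, Finset.card_singleton]; omega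
  have hcC : ∀ {x : Fin n}, x ≠ e → x ∉ C → ({x} ∪ ({e} ∪ C)).card = k := fun h h' => by
    rw [Finset.card_union_of_disjoint (d (by simp [h, h'])), heC1, Finset.card_singleton]; omega
  have hmin : ∀ {S : Finset (Fin n)}, e ∉ S → msign {e} S = 1 := fun {S} h =>
    msign_eq_one_of_lt fun x hx y hy => by
      rw [Finset.mem_singleton] at hx
      subst hx
      have hne : (y : ℕ) ≠ x := fun h' => h (Fin.ext h' ▸ hy)
      rw [Fin.lt_def]
      omega
  have hsgn : ∀ {x : Fin n}, x ≠ e → x ∉ C → msign {x} ({e} ∪ C) = -msign {x} C := by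
    intro x h _
    rw [msign_union_right _ (d heC)]
    have h1 := msign_mul_msign_swap (A := {e}) (B := {x}) (by simpa using h.symm)
    rw [hmin (by simpa using h.symm)] at h1
    simp only [Finset.card_singleton] at h1
    linear_combination msign {x} C * h1
  -- the four decomposable pieces
  have hu : ∀ {x : Fin n}, x ∉ B → (wedge (bform {x} : Lam n 1) (bform B : Lam n (k - 1)) : Lam n k) =
      msign {x} B • bform ({x} ∪ B) := fun h =>
    wedge_bform_of_disjoint (Finset.card_singleton _) hB (d h)
  have hv : ∀ {x : Fin n}, x ≠ e → x ∉ C →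
      (wedge (bform {x} : Lam n 1) (bform ({e} ∪ C) : Lam n (k - 1)) : Lam n k) =
        (-msign {x} C) • bform ({x} ∪ ({e} ∪ C)) := fun h h' => by
    rw [wedge_bform_of_disjoint (Finset.card_singleton _) heC1 (d (by simp [h, h'])), hsgn h h']
  have hz1 : ∀ {x : Fin n}, x ≠ e → x ∉ C → ∀ v : Lam n k,
      pairing e D (bform M : Lam n r) (bform ({x} ∪ ({e} ∪ C))) v = 0 := fun h h' v =>
    pairing_bform_left_eq_zero hD hM (hcC h h') (by simp) v
  have hz2 : ∀ {x : Fin n}, x ≠ e → ∀ w : Lam n k,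
      pairing e D (bform M : Lam n r) w (bform ({x} ∪ B)) = 0 := fun h w =>
    pairing_bform_right_eq_zero _ w (by simp [h.symm, heB])
  have hii := hpair (bform {i}) (bform B + bform ({e} ∪ C))
  have hjj := hpair (bform {j}) (bform B + bform ({e} ∪ C))
  have hsum := hpair (bform {i} + bform {j}) (bform B + bform ({e} ∪ C))
  simp only [wedge_add_left, wedge_add_right, hu hiB, hu hjB, hv hie hiC, hv hje hjC,
    pairing_add_left, pairing_add_right, pairing_smul_left, pairing_smul_right,
    hz1 hie hiC, hz1 hje hjC, hz2 hie, hz2 hje, mul_zero, add_zero, zero_add] at hii hjj hsum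
  have hcomm : ∀ x : Fin n, {x} ∪ ({e} ∪ C) = {e} ∪ ({x} ∪ C) := fun x =>
    Finset.union_left_comm _ _ _
  have hMi : Disjoint M ({i} ∪ B) := by
    rw [Finset.disjoint_union_right]; exact ⟨(d hiM).symm, hMB⟩
  have hMj : Disjoint M ({j} ∪ B) := by
    rw [Finset.disjoint_union_right]; exact ⟨(d hjM).symm, hMB⟩
  have heI : e ∉ I.1 := by rw [hI]; simp [hie.symm, heC]
  have heI' : e ∉ I'.1 := by rw [hI']; simp [hje.symm, heC]
  have h1 := pairing_bform_bform (D := D) (by omega) hM (hcB hiB) hMi I' heI' J' hJ'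
  have h2 := pairing_bform_bform (D := D) (by omega) hM (hcB hjB) hMj I heI J hJ
  rw [hmin heI', hI', ← hcomm j] at h1
  rw [hmin heI, hI, ← hcomm i] at h2
  rw [h1, h2] at hsum
  have hs := exchange_signs hij hMB hiM hjM hiB hjB hiC hjC
  rw [hI, hI', hJ, hJ']
  have hsq : ∀ a b c a' b' c' : Finset (Fin n),
      (msign a a' * msign b b' * msign c c') * (msign a a' * msign b b' * msign c c') = 1 := by
    intro a b c a' b' c'
    linear_combination (msign b b' * msign b b') * (msign c c' * msign c c') * msign_mul_self a a' +
      (msign c c' * msign c c') * msign_mul_self b b' + msign_mul_self c c'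
  have hx := hsq {j} M {i} B ({j} ∪ B) C
  have hy := hsq {i} M {j} B ({i} ∪ B) C
  set s := msign ({i} ∪ C) (M ∪ ({j} ∪ B))
  set s' := msign ({j} ∪ C) (M ∪ ({i} ∪ B))
  set x := msign {j} B * msign M ({j} ∪ B) * msign {i} C with hxd
  set y := msign {i} B * msign M ({i} ∪ B) * msign {j} C with hyd
  have hkey : x * D I J = -y * D I' J' := by
    rw [hxd, hyd]
    linear_combination hii + hjj - hsum
  linear_combination (-(s * D I J)) * hx + s * x * hkey - y * D I' J' * hs + s' * D I' J' * hy

end Exchange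

/-- **Lemma (orthogonality relations, higher degree).** Let `k` be even, `2 ≤ k ≤ n`,
`kp ≤ n`, and for each `A ∈ T¹_{k-1}` let `D^A ∈ Λ^{kp}` with `e^1 ⌟ D^A = 0`.  If
`∑_{A ∈ T¹_{k-1}} ⟨D^A; ω^{p-1}∧(a∧b)⟩⟨a∧b; e^1∧e^A⟩ = 0` for all `ω ∈ Λᵏ`, `a ∈ Λ¹`,
`b ∈ Λ^{k-1}`, then for all `I, R ∈ T¹_{k-1}` and `J, S ∈ T_{kp}` with
`I ∩ J = R ∩ S = ∅` and `I ∪ J = R ∪ S` one has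
`sgn(I,J)⟨D^I;e^J⟩ = sgn(R,S)⟨D^R;e^S⟩`. -/
theorem stmt18 {n k p : ℕ} (hkev : Even k) (hk : 2 ≤ k) (hkn : k ≤ n) (hp : 1 ≤ p)
    (hkp : k * p ≤ n)
    (e1 : Fin n) (he1 : (e1 : ℕ) = 0)
    (D : Idx n (k-1) → Lam n (k*p))
    (hD : ∀ A : Idx n (k-1), e1 ∉ A.1 →
      (iprod (bform {e1} : Lam n 1) (D A) : Lam n (k*p - 1)) = 0)
    (hmain : ∀ (ω : Lam n k) (a : Lam n 1) (b : Lam n (k-1)),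
      ∑ A ∈ Finset.univ.filter (fun A : Idx n (k-1) => e1 ∉ A.1),
        ip (D A) ((wedge (lpow ω (p-1)) ((wedge a b : Lam n k)) : Lam n (k*p))) *
          ip ((wedge a b : Lam n k)) (wedge (bform {e1} : Lam n 1) (bform A.1 : Lam n (k-1))) = 0) :
    ∀ (I R : Idx n (k-1)) (J S : Idx n (k*p)),
      e1 ∉ I.1 → e1 ∉ R.1 → Disjoint I.1 J.1 → Disjoint R.1 S.1 → I.1 ∪ J.1 = R.1 ∪ S.1 →
      msign I.1 J.1 * ip (D I) (bform J.1) = msign R.1 S.1 * ip (D R) (bform S.1) := by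
  have hD' : ∀ A : Idx n (k-1), e1 ∉ A.1 → ∀ J : Idx n (k*p), e1 ∈ J.1 → D A J = 0 :=
    fun A hA J hJ => apply_eq_zero_of_iprod_eq_zero (hD A hA) J hJ
  have hpair : ∀ M : Finset (Fin n), M.card = k * (p - 1) →
      ∀ (a : Lam n 1) (b : Lam n (k-1)),
        pairing e1 D (bform M : Lam n (k * (p - 1))) (wedge a b) (wedge a b) = 0 := by
    intro M hM a b
    obtain ⟨ω, c, hc, hω⟩ := exists_lpow_eq_smul_bform hkev (by omega) hM
    have h := hmain ω a b
    rw [hω] at h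
    have h' : pairing e1 D (c • bform M : Lam n (k * (p - 1))) (wedge a b) (wedge a b) = 0 := h
    rw [pairing_smul] at h'
    exact (mul_eq_zero.1 h').resolve_left hc
  intro I R J S hI hR hIJ hRS hU
  rw [ip_bform, ip_bform]
  by_cases he : e1 ∈ J.1
  · have heS : e1 ∈ S.1 := by
      have : e1 ∈ R.1 ∪ S.1 := hU ▸ Finset.mem_union_right _ he
      exact (Finset.mem_union.1 this).resolve_left hR
    rw [hD' I hI J he, hD' R hR S heS, mul_zero, mul_zero]
  induction hN : (I.1 \ R.1).card generalizing I J with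
  | zero =>
    have hsub : I.1 ⊆ R.1 := Finset.sdiff_eq_empty_iff_subset.1 (Finset.card_eq_zero.1 hN)
    obtain rfl : I = R := Subtype.ext (Finset.eq_of_subset_of_card_le hsub (by rw [I.2, R.2]))
    obtain rfl : J = S := Subtype.ext (by
      rw [← Finset.union_sdiff_cancel_left hIJ, hU, Finset.union_sdiff_cancel_left hRS])
    rfl
  | succ N ih =>
    obtain ⟨i, hi⟩ := Finset.card_pos.1 (by omega : 0 < (I.1 \ R.1).card)
    have hcard : (R.1 \ I.1).card = (I.1 \ R.1).card :=
      Finset.card_sdiff_comm (by rw [I.2, R.2])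
    obtain ⟨j, hj⟩ := Finset.card_pos.1 (by omega : 0 < (R.1 \ I.1).card)
    rw [Finset.mem_sdiff] at hi hj
    have hjJ : j ∈ J.1 := by
      have : j ∈ I.1 ∪ J.1 := hU ▸ Finset.mem_union_left _ hj.1
      exact (Finset.mem_union.1 this).resolve_left hj.2
    have hiJ : i ∉ J.1 := Finset.disjoint_left.1 hIJ hi.1
    have hij : i ≠ j := fun h => hi.2 (h ▸ hj.1)
    have hkp1 : k * p = k * (p - 1) + k := by
      obtain ⟨q, rfl⟩ := Nat.exists_eq_add_of_le' hp
      simp [mul_add]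
    have hJe : (J.1.erase j).card = k * (p - 1) + (k - 1) := by
      rw [Finset.card_erase_of_mem hjJ, J.2]; omega
    obtain ⟨M, hMJ, hM⟩ := Finset.exists_subset_card_eq
      (show k * (p - 1) ≤ (J.1.erase j).card by omega)
    have hB : (J.1.erase j \ M).card = k - 1 := by
      rw [Finset.card_sdiff_of_subset hMJ]; omega
    have hC : (I.1.erase i).card = k - 2 := by
      rw [Finset.card_erase_of_mem hi.1, I.2]; omega
    have hjC : j ∉ I.1.erase i := fun h => hj.2 (Finset.mem_of_mem_erase h)
    have hiJe : i ∉ J.1.erase j := fun h => hiJ (Finset.mem_of_mem_erase h)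
    have hI'c : ({j} ∪ I.1.erase i).card = k - 1 := by
      rw [← Finset.insert_eq, Finset.card_insert_of_notMem hjC, hC]; omega
    have hJ'c : ({i} ∪ J.1.erase j).card = k * p := by
      rw [← Finset.insert_eq, Finset.card_insert_of_notMem hiJe, hJe]; omega
    have hMB : ∀ x : Fin n, M ∪ ({x} ∪ J.1.erase j \ M) = {x} ∪ J.1.erase j := fun x => by
      rw [Finset.union_left_comm, Finset.union_sdiff_of_subset hMJ]
    have hje : j ≠ e1 := fun h => he (h ▸ hjJ)
    have hie : i ≠ e1 := fun h => hI (h ▸ hi.1)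
    have heJ : e1 ∉ J.1.erase j := fun h => he (Finset.mem_of_mem_erase h)
    have step := exchange hk he1 hD' hM hB hC (hpair M hM) hij Finset.disjoint_sdiff
      (fun h => hiJe (hMJ h)) (fun h => Finset.notMem_erase j _ (hMJ h))
      (fun h => hiJe (Finset.mem_sdiff.1 h).1)
      (fun h => Finset.notMem_erase j _ (Finset.mem_sdiff.1 h).1)
      (Finset.notMem_erase i _) hjC (fun h => heJ (hMJ h))
      (fun h => heJ (Finset.mem_sdiff.1 h).1) (fun h => hI (Finset.mem_of_mem_erase h)) hie hje
      I ⟨_, hI'c⟩ J ⟨_, hJ'c⟩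
      (by rw [← Finset.insert_eq, Finset.insert_erase hi.1]) rfl
      (by rw [hMB, ← Finset.insert_eq, Finset.insert_erase hjJ]) (hMB i).symm
    rw [step]
    have hd := Finset.disjoint_left.1 hIJ
    refine ih ⟨_, hI'c⟩ ⟨_, hJ'c⟩ ?_ ?_ ?_ ?_ ?_
    · simp [hje.symm, hI]
    · rw [Finset.disjoint_left]
      intro x hx hx'
      simp only [Finset.mem_union, Finset.mem_singleton, Finset.mem_erase] at hx hx'
      grind
    · rw [← hU]
      ext x
      simp only [Finset.mem_union, Finset.mem_singleton, Finset.mem_erase]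
      grind
    · simp [hie.symm, he]
    · have : ({j} ∪ I.1.erase i) \ R.1 = (I.1 \ R.1).erase i := by
        ext x
        simp only [Finset.mem_sdiff, Finset.mem_union, Finset.mem_singleton, Finset.mem_erase]
        grind
      rw [this, Finset.card_erase_of_mem (Finset.mem_sdiff.2 hi), hN]
      omega
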